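/- Let β, β′ ∈ ℬ. Then the reflection s_{β′} maps Δ(β) onto itself; moreover, if the restriction of s_{β′} to Δ(β) is not the identity, then β′ ∈ Δ(β), so that s_{β′} lies in the Weyl group of Δ(β). -/

import Mathlib

open scoped InnerProductSpace BigOperators

structure RootSystemData (V : Type*) [NormedAddCommGroup V] [InnerProductSpace ℝ V] where
  Δ : Set V
  finite : Δ.Finite
  span_top : Submodule.span ℝ Δ = ⊤
  zero_not_mem : (0 : V) ∉ Δ
  neg_mem : ∀ α ∈ Δ, -α ∈ Δ
  reduced : ∀ α ∈ Δ, ∀ t : ℝ, t • α ∈ Δ → t = 1 ∨ t = -1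
  crystal : ∀ α ∈ Δ, ∀ β ∈ Δ, ∃ n : ℤ, 2 * ⟪α, β⟫_ℝ = (n : ℝ) * ⟪β, β⟫_ℝ
  reflect_mem : ∀ α ∈ Δ, ∀ β ∈ Δ, α - (2 * ⟪α, β⟫_ℝ / ⟪β, β⟫_ℝ) • β ∈ Δ
  Pos : Set V
  pos_subset : Pos ⊆ Δ
  mem_or_neg : ∀ α ∈ Δ, α ∈ Pos ∨ -α ∈ Pos
  not_neg_mem : ∀ α ∈ Pos, -α ∉ Pos
  pos_add : ∀ α ∈ Pos, ∀ β ∈ Pos, α + β ∈ Δ → α + β ∈ Pos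

namespace RootSystemData

variable {V : Type*} [NormedAddCommGroup V] [InnerProductSpace ℝ V] (R : RootSystemData V)

/-- The set of simple roots: indecomposable positive roots. -/
def Simple : Set V := {α ∈ R.Pos | ¬ ∃ β ∈ R.Pos, ∃ γ ∈ R.Pos, α = β + γ}

/-- The support `Π(φ)` of a positive root: the simple roots needed to express `φ`. -/
def support (φ : V) : Set V := {α ∈ R.Simple | φ ∉ Submodule.span ℝ (R.Simple \ {α})}

/-- The root subsystem `Δ(φ)`: all roots lying in the span of the support of `φ`. -/
def sub (φ : V) : Set V := {ψ ∈ R.Δ | ψ ∈ Submodule.span ℝ (R.support φ)}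

/-- The positive roots `Δ(φ)₊` of the subsystem `Δ(φ)`. -/
def posSub (φ : V) : Set V := R.sub φ ∩ R.Pos

/-- `x` is a nonnegative integer combination of positive roots. -/
def NonnegComb (x : V) : Prop :=
  ∃ c : V →₀ ℕ, ↑c.support ⊆ R.Pos ∧ x = c.sum fun α n => (n : ℝ) • α

/-- `β` is the highest root of the subset `S`. -/
def IsHighest (S : Set V) (β : V) : Prop :=
  β ∈ S ∧ β ∈ R.Pos ∧ ∀ ψ ∈ S, R.NonnegComb (β - ψ)

/-- `β` is locally high: it is the highest root of `Δ(β)`. -/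
def LocallyHigh (β : V) : Prop := β ∈ R.Pos ∧ R.IsHighest (R.sub β) β

/-- `E(β) = {φ ∈ Δ(β) : (φ,β) > 0}`. -/
def E (β : V) : Set V := {φ ∈ R.sub β | 0 < ⟪φ, β⟫_ℝ}

/-- `Δ(β)° = {φ ∈ Δ(β) : (φ,β) = 0}`. -/
def orth (β : V) : Set V := {φ ∈ R.sub β | ⟪φ, β⟫_ℝ = 0}

/-- Strong orthogonality of two roots. -/
def StronglyOrth (φ ψ : V) : Prop := φ + ψ ∉ R.Δ ∧ φ - ψ ∉ R.Δ


/-- Half the sum of the positive roots of `Δ(β)`. -/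
noncomputable def rho (β : V) : V := (2⁻¹ : ℝ) • ∑ᶠ φ ∈ R.posSub β, φ

/-- The dual Coxeter number of `Δ(β)`, `⟨ρ_β, β^∨⟩ + 1`. -/
noncomputable def dualCoxeter (β : V) : ℝ := 2 * ⟪R.rho β, β⟫_ℝ / ⟪β, β⟫_ℝ + 1

end RootSystemData

/-- A finite set of vectors is irreducible if it is nonempty and admits no splitting into
two nonempty mutually orthogonal pieces. -/
def IsIrred {V : Type*} [NormedAddCommGroup V] [InnerProductSpace ℝ V] (S : Set V) : Prop :=
  S.Nonempty ∧ ¬ ∃ A B : Set V, A ∪ B = S ∧ A ∩ B = ∅ ∧ A.Nonempty ∧ B.Nonempty ∧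
    ∀ a ∈ A, ∀ b ∈ B, ⟪a, b⟫_ℝ = 0

/-- `C` is an irreducible component of `S`. -/
def IsComponent {V : Type*} [NormedAddCommGroup V] [InnerProductSpace ℝ V]
    (S C : Set V) : Prop :=
  C ⊆ S ∧ IsIrred C ∧ ∀ a ∈ C, ∀ b ∈ S \ C, ⟪a, b⟫_ℝ = 0

/-- The reflection `s_β` in the (co)vector `β`. -/
noncomputable def reflectRoot {V : Type*} [NormedAddCommGroup V] [InnerProductSpace ℝ V]
    (β v : V) : V := v - (2 * ⟪v, β⟫_ℝ / ⟪β, β⟫_ℝ) • β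

namespace RootSystemData

variable {V : Type*} [NormedAddCommGroup V] [InnerProductSpace ℝ V] (R : RootSystemData V)

/-- A chain cascade: a nonempty list whose head is the highest root of an irreducible
component of `Δ`, and each subsequent entry is the highest root of an irreducible component
of `Δ(previous)°`. -/
def IsChainCascade (l : List V) : Prop :=
  l ≠ [] ∧
  (∀ b ∈ l.head?, ∃ C, IsComponent R.Δ C ∧ R.IsHighest C b) ∧
  l.Chain' fun γ δ => ∃ C, IsComponent (R.orth γ) C ∧ R.IsHighest C δ

/-- The cascade `ℬ` of roots: all positive roots belonging to some chain cascade. -/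
def cascade : Set V := {β | ∃ l, R.IsChainCascade l ∧ β ∈ l}

/-- `l` is the chain cascade `C(φ)` associated to the positive root `φ`. -/
def IsCascadeChainOf (φ : V) (l : List V) : Prop :=
  R.IsChainCascade l ∧ (∀ β ∈ l, φ ∈ R.sub β) ∧
  (∀ β ∈ l.dropLast, ⟪φ, β⟫_ℝ = 0) ∧ ∀ β ∈ l.getLast?, 0 < ⟪φ, β⟫_ℝ

end RootSystemData

lemma IsComponent.subset_of_inter_nonempty {V : Type*} [NormedAddCommGroup V]
    [InnerProductSpace ℝ V] {D C C' : Set V} (hC : IsComponent D C)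
    (hC' : IsComponent D C') (h : (C ∩ C').Nonempty) : C ⊆ C' := by
  by_contra hsub
  obtain ⟨x, hx, hx'⟩ := Set.not_subset.1 hsub
  refine hC.2.1.2 ⟨C ∩ C', C \ C', Set.inter_union_sdiff C C', ?_, h, ⟨x, hx, hx'⟩, ?_⟩
  · exact (Set.disjoint_left.2 fun a ha ha' => ha'.2 ha.2).inter_eq
  · exact fun a ha a' ha' => hC'.2.2 a ha.2 a' ⟨hC.1 ha'.1, ha'.2⟩

lemma IsComponent.eq_or_orthogonal {V : Type*} [NormedAddCommGroup V]
    [InnerProductSpace ℝ V] {D C C' : Set V} (hC : IsComponent D C)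
    (hC' : IsComponent D C') : C = C' ∨ ∀ a ∈ C, ∀ a' ∈ C', ⟪a, a'⟫_ℝ = 0 := by
  rcases (C ∩ C').eq_empty_or_nonempty with h | h
  · exact .inr fun a ha a' ha' => hC.2.2 a ha a' ⟨hC'.1 ha', fun hm => h.le ⟨hm, ha'⟩⟩
  · exact .inl ((hC.subset_of_inter_nonempty hC' h).antisymm
      (hC'.subset_of_inter_nonempty hC (by rwa [Set.inter_comm])))

namespace RootSystemData

variable {V : Type*} [NormedAddCommGroup V] [InnerProductSpace ℝ V] {R : RootSystemData V}

/-! ### Positive roots -/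

lemma inner_self_pos {α : V} (hα : α ∈ R.Δ) : 0 < ⟪α, α⟫_ℝ :=
  real_inner_self_pos.2 fun h => R.zero_not_mem (h ▸ hα)

lemma inner_reflectRoot {β : V} (hβ : β ∈ R.Δ) (v : V) :
    ⟪reflectRoot β v, β⟫_ℝ = -⟪v, β⟫_ℝ := by
  have hββ := inner_self_pos hβ
  rw [reflectRoot, inner_sub_left, real_inner_smul_left]
  field_simp
  ring

lemma reflectRoot_reflectRoot {β : V} (hβ : β ∈ R.Δ) (v : V) :
    reflectRoot β (reflectRoot β v) = v := by
  rw [reflectRoot, inner_reflectRoot hβ, reflectRoot, sub_sub, ← add_smul]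
  ring_nf
  simp

lemma add_mem_of_inner_neg {x y : V} (hx : x ∈ R.Δ) (hy : y ∈ R.Δ) (h : ⟪x, y⟫_ℝ < 0)
    (hne : x + y ≠ 0) : x + y ∈ R.Δ := by
  obtain ⟨n, hn⟩ := R.crystal x hx y hy
  obtain ⟨m, hm⟩ := R.crystal y hy x hx
  have hxx := inner_self_pos hx
  have hyy := inner_self_pos hy
  have hyx : ⟪y, x⟫_ℝ < 0 := by rwa [real_inner_comm]
  have hn0 : n < 0 := by
    by_contra! hc
    have : (0 : ℝ) ≤ n := by exact_mod_cast hc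
    nlinarith
  have hm0 : m < 0 := by
    by_contra! hc
    have : (0 : ℝ) ≤ m := by exact_mod_cast hc
    nlinarith
  by_cases hn1 : n = -1
  · have := R.reflect_mem x hx y hy
    rw [hn, hn1, mul_div_cancel_right₀ _ hyy.ne'] at this
    simpa using this
  by_cases hm1 : m = -1
  · have := R.reflect_mem y hy x hx
    rw [hm, hm1, mul_div_cancel_right₀ _ hxx.ne'] at this
    simpa [add_comm] using this
  have hn2 : (n : ℝ) ≤ -2 := by exact_mod_cast (by lia : n ≤ -2)
  have hm2 : (m : ℝ) ≤ -2 := by exact_mod_cast (by lia : m ≤ -2)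
  have h0 : 0 < ⟪x + y, x + y⟫_ℝ := real_inner_self_pos.2 hne
  rw [real_inner_add_add_self] at h0
  rw [real_inner_comm] at hm
  nlinarith

lemma sub_mem_of_inner_pos {x y : V} (hx : x ∈ R.Δ) (hy : y ∈ R.Δ) (h : 0 < ⟪x, y⟫_ℝ)
    (hne : x ≠ y) : x - y ∈ R.Δ := by
  rw [sub_eq_add_neg]
  refine add_mem_of_inner_neg hx (R.neg_mem y hy) (by simpa using h) ?_
  rwa [← sub_eq_add_neg, sub_ne_zero]

lemma add_multiset_sum_ne_zero (s : Multiset V) (hs : ∀ x ∈ s, x ∈ R.Pos) {α : V}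
    (hα : α ∈ R.Pos) : α + s.sum ≠ 0 := by
  induction hk : s.card generalizing s α with
  | zero =>
    rw [Multiset.card_eq_zero] at hk
    subst hk
    intro h
    simp only [Multiset.sum_zero, add_zero] at h
    exact R.zero_not_mem (h ▸ R.pos_subset hα)
  | succ k ih =>
    intro h
    have hex : ∃ b ∈ s, ⟪α, b⟫_ℝ < 0 := by
      by_contra! hc
      have h1 : ⟪α, s.sum⟫_ℝ = (s.map fun b => ⟪α, b⟫_ℝ).sum :=
        map_multiset_sum (innerₗ V α) s
      have h2 : 0 ≤ (s.map fun b => ⟪α, b⟫_ℝ).sum := by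
        refine Multiset.sum_nonneg fun x hx => ?_
        obtain ⟨b, hb, rfl⟩ := Multiset.mem_map.1 hx
        exact hc b hb
      have h3 : s.sum = -α := by rw [eq_neg_iff_add_eq_zero, add_comm, h]
      have h4 := inner_self_pos (R.pos_subset hα)
      rw [← h1, h3, inner_neg_right] at h2
      linarith
    obtain ⟨b, hb, hneg⟩ := hex
    obtain ⟨t, rfl⟩ := Multiset.exists_cons_of_mem hb
    have hbp := hs b hb
    have hne : α + b ≠ 0 := fun h0 =>
      R.not_neg_mem α hα (by rwa [← eq_neg_of_add_eq_zero_right h0])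
    have hab := R.pos_add α hα b hbp
      (add_mem_of_inner_neg (R.pos_subset hα) (R.pos_subset hbp) hneg hne)
    refine ih t (fun x hx => hs x (Multiset.mem_cons_of_mem hx)) hab (by simpa using hk) ?_
    rw [← h, Multiset.sum_cons, add_assoc]

lemma add_ne_zero_of_mem_closure {α y : V} (hα : α ∈ R.Pos)
    (hy : y ∈ AddSubmonoid.closure R.Pos) : α + y ≠ 0 := by
  obtain ⟨s, hs, rfl⟩ := AddSubmonoid.exists_multiset_of_mem_closure hy
  exact add_multiset_sum_ne_zero s hs hα

/-! ### Simple roots -/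

lemma sub_simple_mem_pos {α β : V} (hα : α ∈ R.Simple) (hβ : β ∈ R.Pos) (h : β - α ∈ R.Δ) :
    β - α ∈ R.Pos := by
  refine (R.mem_or_neg _ h).resolve_right fun hn => hα.2 ⟨β, hβ, _, hn, ?_⟩
  abel

lemma eq_simple_of_add_eq_nsmul {α : V} (hα : α ∈ R.Simple) (n : ℕ) {β δ : V} (hβ : β ∈ R.Pos)
    (hδ : δ ∈ R.Pos) (h : β + δ = n • α) : β = α := by
  have hαΔ := R.pos_subset hα.1
  induction n generalizing β δ with
  | zero =>
    rw [zero_smul] at h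
    exact (R.not_neg_mem β hβ (by rwa [← eq_neg_of_add_eq_zero_right h])).elim
  | succ k ih =>
    have hpos : 0 < ⟪β, α⟫_ℝ + ⟪δ, α⟫_ℝ := by
      rw [← inner_add_left, h, ← Nat.cast_smul_eq_nsmul ℝ, real_inner_smul_left]
      have := inner_self_pos hαΔ
      positivity
    rcases lt_or_ge 0 ⟪β, α⟫_ℝ with hb | hb
    · by_contra hne
      have hp := sub_simple_mem_pos hα hβ
        (sub_mem_of_inner_pos (R.pos_subset hβ) hαΔ hb hne)
      have h1 : β - α = α := ih hp hδ (by rw [sub_add_eq_add_sub, h, succ_nsmul]; abel)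
      have h2 : β = (2 : ℝ) • α := by rw [two_smul, ← sub_eq_iff_eq_add, h1]
      have := R.reduced α hαΔ 2 (h2 ▸ R.pos_subset hβ)
      norm_num at this
    · by_cases hne : δ = α
      · have h2 : β = (k : ℝ) • α := by
          rw [Nat.cast_smul_eq_nsmul]
          rw [hne, succ_nsmul] at h
          exact add_right_cancel h
        rcases R.reduced α hαΔ k (h2 ▸ R.pos_subset hβ) with h3 | h3
        · rw [h2, h3, one_smul]
        · have : (0 : ℝ) ≤ k := k.cast_nonneg
          linarith
      · have hp := sub_simple_mem_pos hα hδ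
          (sub_mem_of_inner_pos (R.pos_subset hδ) hαΔ (by linarith) hne)
        exact ih hβ hp (by rw [add_sub_assoc', h, succ_nsmul]; abel)

lemma reflectRoot_mem_pos {α β : V} (hα : α ∈ R.Simple) (hβ : β ∈ R.Pos) (hne : β ≠ α) :
    reflectRoot α β ∈ R.Pos := by
  have hαΔ := R.pos_subset hα.1
  have hαα := inner_self_pos hαΔ
  have hmem : reflectRoot α β ∈ R.Δ := R.reflect_mem β (R.pos_subset hβ) α hαΔ
  refine (R.mem_or_neg _ hmem).resolve_right fun hn => ?_
  obtain ⟨n, hn'⟩ := R.crystal β (R.pos_subset hβ) α hαΔ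
  rw [reflectRoot, hn', mul_div_cancel_right₀ _ hαα.ne', Int.cast_smul_eq_zsmul] at hn
  rcases le_total 0 n with h0 | h0
  · lift n to ℕ using h0
    exact hne (eq_simple_of_add_eq_nsmul hα n hβ hn (by rw [natCast_zsmul]; abel))
  · obtain ⟨k, hk⟩ := Int.eq_ofNat_of_zero_le (neg_nonneg.2 h0)
    obtain rfl := neg_eq_iff_eq_neg.1 hk
    refine add_ne_zero_of_mem_closure hβ (add_mem (AddSubmonoid.subset_closure hn)
      (nsmul_mem (AddSubmonoid.subset_closure hα.1) k)) ?_
    rw [neg_smul, natCast_zsmul]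
    abel

lemma exists_forall_simple_inner_pos (R : RootSystemData V) :
    ∃ ρ : V, ∀ α ∈ R.Simple, 0 < ⟪ρ, α⟫_ℝ := by
  classical
  have hfin : R.Pos.Finite := R.finite.subset R.pos_subset
  refine ⟨∑ β ∈ hfin.toFinset, β, fun α hα => ?_⟩
  have hαΔ := R.pos_subset hα.1
  have hαα := inner_self_pos hαΔ
  rw [sum_inner, ← Finset.add_sum_erase _ _ (hfin.mem_toFinset.2 hα.1)]
  have hzero : ∑ β ∈ hfin.toFinset.erase α, ⟪β, α⟫_ℝ = 0 := by
    have hinner := inner_reflectRoot hαΔ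
    refine Finset.sum_involution (fun β _ => reflectRoot α β) ?_ ?_ ?_ ?_
    · intro β _
      simp [hinner]
    · intro β _ h0 he
      have := hinner β
      rw [he] at this
      exact h0 (by linarith)
    · intro β hβ
      rw [Finset.mem_erase, hfin.mem_toFinset] at hβ ⊢
      refine ⟨fun he => ?_, reflectRoot_mem_pos hα hβ.2 hβ.1⟩
      have h1 : β = (1 + 2 * ⟪β, α⟫_ℝ / ⟪α, α⟫_ℝ) • α := by
        rw [add_smul, one_smul, ← sub_eq_iff_eq_add]
        exact he
      rcases R.reduced α hαΔ _ (h1 ▸ R.pos_subset hβ.2) with h2 | h2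
      · exact hβ.1 (by rw [h1, h2, one_smul])
      · rw [h2, neg_one_smul] at h1
        exact R.not_neg_mem α hα.1 (h1 ▸ hβ.2)
    · exact fun β _ => reflectRoot_reflectRoot hαΔ β
  rw [hzero, add_zero]
  exact hαα

lemma pos_subset_closure_simple (R : RootSystemData V) :
    R.Pos ⊆ AddSubmonoid.closure R.Simple := by
  intro α hα
  induction hk : {β ∈ R.Pos | α - β ∈ AddSubmonoid.closure R.Pos}.ncard using
    Nat.strong_induction_on generalizing α with
  | _ k ih =>
  have hfin : R.Pos.Finite := R.finite.subset R.pos_subset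
  have hlt : ∀ β ∈ R.Pos, ∀ γ ∈ R.Pos, α = β + γ →
      {δ ∈ R.Pos | β - δ ∈ AddSubmonoid.closure R.Pos}.ncard < k := by
    intro β hβ γ hγ h
    rw [← hk]
    refine Set.ncard_lt_ncard ⟨fun δ hδ => ⟨hδ.1, ?_⟩, fun hsub => ?_⟩
      (hfin.subset fun x hx => hx.1)
    · have : α - δ = (β - δ) + γ := by rw [h]; abel
      rw [this]
      exact add_mem hδ.2 (AddSubmonoid.subset_closure hγ)
    · have h1 := (hsub ⟨hα, by rw [sub_self]; exact zero_mem _⟩).2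
      exact add_ne_zero_of_mem_closure hγ h1 (by rw [h]; abel)
  by_cases hs : α ∈ R.Simple
  · exact AddSubmonoid.subset_closure hs
  · have : ∃ β ∈ R.Pos, ∃ γ ∈ R.Pos, α = β + γ := by
      by_contra hc
      exact hs ⟨hα, hc⟩
    obtain ⟨β, hβ, γ, hγ, h⟩ := this
    rw [h]
    exact add_mem (ih _ (hlt β hβ γ hγ h) hβ rfl)
      (ih _ (hlt γ hγ β hβ (by rw [h, add_comm])) hγ rfl)

lemma exists_basis_simple (R : RootSystemData V) :
    ∃ b : Module.Basis R.Simple ℝ V, ∀ i, b i = i := by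
  obtain ⟨ρ, hρ⟩ := exists_forall_simple_inner_pos R
  have hli : LinearIndependent ℝ (fun i : R.Simple => (i : V)) := by
    refine LinearMap.BilinForm.linearIndependent_of_pairwise_le_zero (innerₗ V) ?_ (innerₗ V ρ) _
      (fun i => hρ i i.2) fun i j hij => ?_
    · intro x hx
      exact real_inner_self_pos.2 hx
    · by_contra! hc
      have hi := R.pos_subset i.2.1
      have hj := R.pos_subset j.2.1
      have hd := sub_mem_of_inner_pos hi hj hc fun h => hij (Subtype.ext h)
      rcases R.mem_or_neg _ hd with h | h
      · exact i.2.2 ⟨_, h, j, j.2.1, by abel⟩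
      · exact j.2.2 ⟨_, h, i, i.2.1, by abel⟩
  refine ⟨Module.Basis.mk hli ?_, fun i => Module.Basis.mk_apply hli _ i⟩
  rw [← R.span_top, Subtype.range_coe, Submodule.span_le]
  have hpos : ∀ x ∈ R.Pos, x ∈ Submodule.span ℝ R.Simple := fun x hx =>
    (AddSubmonoid.closure_le (S := (Submodule.span ℝ R.Simple).toAddSubmonoid)).2
      Submodule.subset_span (pos_subset_closure_simple R hx)
  intro x hx
  rcases R.mem_or_neg x hx with h | h
  · exact hpos x h
  · exact (Submodule.neg_mem_iff _).1 (hpos _ h)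

lemma NonnegComb.mem_closure {x : V} (hx : R.NonnegComb x) : x ∈ AddSubmonoid.closure R.Pos := by
  obtain ⟨c, hc, rfl⟩ := hx
  refine sum_mem fun α hα => ?_
  dsimp only
  rw [Nat.cast_smul_eq_nsmul]
  exact nsmul_mem (AddSubmonoid.subset_closure (hc hα)) _

/-! ### Supports in terms of coordinates -/

section Coordinates

variable {b : Module.Basis R.Simple ℝ V} (hb : ∀ i, b i = i)

include hb

lemma inner_eq_sum_repr (x y : V) :
    ⟪x, y⟫_ℝ = ∑ i ∈ (b.repr y).support, b.repr y i * ⟪x, (i : V)⟫_ℝ := by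
  conv_lhs => rw [← b.linearCombination_repr y]
  rw [Finsupp.linearCombination_apply, Finsupp.sum, inner_sum]
  simp only [real_inner_smul_right, hb]

lemma repr_nonneg_of_mem_closure_simple {x : V} (hx : x ∈ AddSubmonoid.closure R.Simple)
    (i : R.Simple) : 0 ≤ b.repr x i := by
  induction hx using AddSubmonoid.closure_induction with
  | mem y hy =>
    have : b.repr y = Finsupp.single ⟨y, hy⟩ 1 := by rw [← b.repr_self, hb]
    rw [this]
    exact Finsupp.single_nonneg.2 zero_le_one i
  | zero => simp
  | add y z _ _ hy hz =>
    rw [map_add, Finsupp.add_apply]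
    exact add_nonneg hy hz

lemma repr_nonneg_of_mem_closure {x : V} (hx : x ∈ AddSubmonoid.closure R.Pos) (i : R.Simple) :
    0 ≤ b.repr x i :=
  repr_nonneg_of_mem_closure_simple hb
    (AddSubmonoid.closure_le.2 (pos_subset_closure_simple R) hx) i

lemma eq_of_isHighest {C : Set V} {β β' : V} (h : R.IsHighest C β) (h' : R.IsHighest C β') :
    β = β' := by
  refine b.repr.injective (Finsupp.ext fun i => le_antisymm ?_ ?_)
  · simpa using repr_nonneg_of_mem_closure hb (h'.2.2 β h.1).mem_closure i
  · simpa using repr_nonneg_of_mem_closure hb (h.2.2 β' h'.1).mem_closure i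

lemma mem_support_iff {φ : V} (i : R.Simple) : (i : V) ∈ R.support φ ↔ b.repr φ i ≠ 0 := by
  have : R.Simple \ {(i : V)} = b '' {i}ᶜ := by
    ext x
    simp only [hb, Set.mem_sdiff, Set.mem_singleton_iff, Set.mem_image, Set.mem_compl_iff]
    constructor
    · rintro ⟨hx, hne⟩
      exact ⟨⟨x, hx⟩, fun h => hne (by rw [← h]), rfl⟩
    · rintro ⟨j, hj, rfl⟩
      exact ⟨j.2, fun h => hj (Subtype.ext h)⟩
  rw [support, Set.mem_ofPred_eq, this, b.mem_span_image]
  simp [Set.subset_compl_singleton_iff]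

lemma mem_sub_iff {φ ψ : V} :
    ψ ∈ R.sub φ ↔ ψ ∈ R.Δ ∧ ∀ i, b.repr ψ i ≠ 0 → b.repr φ i ≠ 0 := by
  have : R.support φ = b '' {i | b.repr φ i ≠ 0} := by
    ext x
    constructor
    · intro hx
      exact ⟨⟨x, hx.1⟩, (mem_support_iff hb ⟨x, hx.1⟩).1 hx, hb _⟩
    · rintro ⟨i, hi, rfl⟩
      rw [hb]
      exact (mem_support_iff hb i).2 hi
  rw [sub, Set.mem_ofPred_eq, this, b.mem_span_image]
  refine and_congr_right fun _ => forall_congr' fun i => ?_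
  rw [Finset.mem_coe, Finsupp.mem_support_iff, Set.mem_ofPred_eq]

lemma mem_sub_self {φ : V} (hφ : φ ∈ R.Δ) : φ ∈ R.sub φ :=
  (mem_sub_iff hb).2 ⟨hφ, fun _ h => h⟩

end Coordinates

/-! ### Standard parabolic subsystems -/

/-- `D` consists of all roots supported on some fixed set of simple roots. -/
def IsStandard (b : Module.Basis R.Simple ℝ V) (D : Set V) : Prop :=
  ∃ J : Set R.Simple, D = {ψ ∈ R.Δ | ∀ i, b.repr ψ i ≠ 0 → i ∈ J}

section Standard

variable {b : Module.Basis R.Simple ℝ V} (hb : ∀ i, b i = i)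

include hb

lemma IsStandard.simple_mem {D : Set V} (hD : IsStandard b D) {ψ : V} (hψ : ψ ∈ D) {i : R.Simple}
    (hi : b.repr ψ i ≠ 0) : (i : V) ∈ D := by
  obtain ⟨J, rfl⟩ := hD
  refine ⟨R.pos_subset i.2.1, fun j hj => ?_⟩
  rw [← hb, b.repr_self, Finsupp.single_apply_ne_zero] at hj
  rw [hj.1]
  exact hψ.2 i hi

lemma simple_mem_component {D C : Set V} (hD : IsStandard b D) (hC : IsComponent D C) {β : V}
    (hβ : β ∈ C) {i : R.Simple} (hi : b.repr β i ≠ 0) : (i : V) ∈ C := by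
  classical
  by_contra hiC
  set s := (b.repr β).support with hs
  set x := ∑ j ∈ s.filter (fun j : R.Simple => (j : V) ∉ C), b.repr β j • (j : V) with hx
  set y := ∑ j ∈ s.filter (fun j : R.Simple => (j : V) ∈ C), b.repr β j • (j : V) with hy
  have horth : ∀ a ∈ C, ⟪a, x⟫_ℝ = 0 := fun a ha => by
    rw [hx, inner_sum]
    refine Finset.sum_eq_zero fun j hj => ?_
    rw [Finset.mem_filter, hs, Finsupp.mem_support_iff] at hj
    rw [real_inner_smul_right, hC.2.2 a ha j ⟨hD.simple_mem hb (hC.1 hβ) hj.1, hj.2⟩, mul_zero]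
  have hyx : ⟪y, x⟫_ℝ = 0 := by
    rw [hy, sum_inner]
    refine Finset.sum_eq_zero fun j hj => ?_
    rw [real_inner_smul_left, horth j (Finset.mem_filter.1 hj).2, mul_zero]
  have hsum : y + x = β := by
    rw [hx, hy, Finset.sum_filter_add_sum_filter_not]
    conv_rhs => rw [← b.linearCombination_repr β]
    rw [Finsupp.linearCombination_apply, Finsupp.sum]
    simp only [hb, hs]
  have hxx : ⟪x, x⟫_ℝ = 0 := by
    have := horth β hβ
    rwa [← hsum, inner_add_left, hyx, zero_add] at this
  have hx0 := inner_self_eq_zero.1 hxx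
  have hli := linearIndependent_iff'.1 b.linearIndependent
    (s.filter fun j : R.Simple => (j : V) ∉ C) (b.repr β) (by simpa only [hb, hx] using hx0) i
    (Finset.mem_filter.2 ⟨Finsupp.mem_support_iff.2 hi, hiC⟩)
  exact hi hli

lemma sub_subset_component {D C : Set V} (hD : IsStandard b D) (hC : IsComponent D C) {β : V}
    (hβ : β ∈ C) : R.sub β ⊆ C := by
  intro ψ hψ
  obtain ⟨hψΔ, hsupp⟩ := (mem_sub_iff hb).1 hψ
  have hψD : ψ ∈ D := by
    have hβD := hC.1 hβ
    obtain ⟨J, rfl⟩ := hD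
    exact ⟨hψΔ, fun i hi => hβD.2 i (hsupp i hi)⟩
  by_contra hψC
  refine (inner_self_pos hψΔ).ne' ?_
  rw [inner_eq_sum_repr hb]
  refine Finset.sum_eq_zero fun i hi => ?_
  have hiC := simple_mem_component hb hD hC hβ (hsupp i (Finsupp.mem_support_iff.1 hi))
  rw [real_inner_comm, hC.2.2 i hiC ψ ⟨hψD, hψC⟩, mul_zero]

lemma isHighest_sub {D C : Set V} (hD : IsStandard b D) (hC : IsComponent D C) {β : V}
    (hβ : R.IsHighest C β) : R.IsHighest (R.sub β) β :=
  ⟨mem_sub_self hb (R.pos_subset hβ.2.1), hβ.2.1, fun ψ hψ =>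
    hβ.2.2 ψ (sub_subset_component hb hD hC hβ.1 hψ)⟩

lemma simple_inner_nonneg {γ : V} (hγ : R.IsHighest (R.sub γ) γ) {i : R.Simple}
    (hi : b.repr γ i ≠ 0) : 0 ≤ ⟪γ, (i : V)⟫_ℝ := by
  classical
  by_contra! hneg
  have hi' : (i : V) ∈ AddSubmonoid.closure R.Pos := AddSubmonoid.subset_closure i.2.1
  have hmem : γ + i ∈ R.sub γ := by
    refine (mem_sub_iff hb).2 ⟨add_mem_of_inner_neg (R.pos_subset hγ.2.1) (R.pos_subset i.2.1) hneg
      (add_ne_zero_of_mem_closure hγ.2.1 hi'), fun j hj hj0 => ?_⟩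
    have hji : i ≠ j := fun h => hi (h ▸ hj0)
    rw [map_add, Finsupp.add_apply, hj0, ← hb, b.repr_self, Finsupp.single_eq_of_ne' hji] at hj
    exact hj (add_zero 0)
  exact add_ne_zero_of_mem_closure i.2.1 (hγ.2.2 _ hmem).mem_closure (by abel)

lemma isStandard_orth {γ : V} (hγ : R.IsHighest (R.sub γ) γ) : IsStandard b (R.orth γ) := by
  refine ⟨{i | b.repr γ i ≠ 0 ∧ ⟪γ, (i : V)⟫_ℝ = 0}, Set.ext fun ψ => ⟨?_, ?_⟩⟩
  · have key : ∀ ψ ∈ R.Pos, ψ ∈ R.orth γ → ∀ i, b.repr ψ i ≠ 0 →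
        b.repr γ i ≠ 0 ∧ ⟪γ, (i : V)⟫_ℝ = 0 := by
      rintro ψ hψ ⟨hsub, h0⟩ i hi
      obtain ⟨-, hsupp⟩ := (mem_sub_iff hb).1 hsub
      refine ⟨hsupp i hi, ?_⟩
      rw [real_inner_comm, inner_eq_sum_repr hb, Finset.sum_eq_zero_iff_of_nonneg] at h0
      · exact (mul_eq_zero.1 (h0 i (Finsupp.mem_support_iff.2 hi))).resolve_left hi
      · intro j hj
        exact mul_nonneg (repr_nonneg_of_mem_closure hb (AddSubmonoid.subset_closure hψ) j)
          (simple_inner_nonneg hb hγ (hsupp j (Finsupp.mem_support_iff.1 hj)))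
    intro h
    refine ⟨h.1.1, fun i hi => ?_⟩
    rcases R.mem_or_neg ψ h.1.1 with hp | hp
    · exact key ψ hp h i hi
    · exact key _ hp ⟨⟨R.neg_mem _ h.1.1, Submodule.neg_mem _ h.1.2⟩,
        by rw [inner_neg_left, h.2, neg_zero]⟩ i (by simpa using hi)
  · rintro ⟨hψ, h⟩
    refine ⟨(mem_sub_iff hb).2 ⟨hψ, fun i hi => (h i hi).1⟩, ?_⟩
    rw [real_inner_comm, inner_eq_sum_repr hb]
    refine Finset.sum_eq_zero fun i hi => ?_
    rw [(h i (Finsupp.mem_support_iff.1 hi)).2, mul_zero]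

end Standard

/-! ### Chains of components -/

/-- `δ` is the highest root of an irreducible component of `D`. -/
def IsComponentTop (R : RootSystemData V) (D : Set V) (δ : V) : Prop :=
  ∃ C, IsComponent D C ∧ R.IsHighest C δ

section Chains

variable {b : Module.Basis R.Simple ℝ V} (hb : ∀ i, b i = i)

include hb

lemma mem_pos_and_sub_subset_of_isChain {t : List V} {g : V} {D : Set V} (hD : IsStandard b D)
    (hg : R.IsComponentTop D g)
    (hl : (g :: t).IsChain fun γ δ => R.IsComponentTop (R.orth γ) δ) :
    ∀ β ∈ g :: t, β ∈ R.Pos ∧ R.sub β ⊆ R.sub g ∧ (β ∈ t → R.sub β ⊆ R.orth g) := by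
  induction t generalizing g D with
  | nil =>
    intro β hβ
    obtain rfl := List.mem_singleton.1 hβ
    obtain ⟨C, -, hC⟩ := hg
    exact ⟨hC.2.1, subset_rfl, by simp⟩
  | cons g' t ih =>
    obtain ⟨C, hDC, hC⟩ := hg
    obtain ⟨hg', hl⟩ := List.isChain_cons_cons.1 hl
    have hD' := isStandard_orth hb (isHighest_sub hb hD hDC hC)
    have key : ∀ β ∈ g' :: t, β ∈ R.Pos ∧ R.sub β ⊆ R.orth g := by
      intro β hβ
      obtain ⟨hβp, hβ', -⟩ := ih hD' hg' hl β hβ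
      obtain ⟨C', hDC', hC'⟩ := hg'
      exact ⟨hβp, hβ'.trans ((sub_subset_component hb hD' hDC' hC'.1).trans hDC'.1)⟩
    intro β hβ
    rcases List.mem_cons.1 hβ with rfl | hβ
    · exact ⟨hC.2.1, subset_rfl, fun h => (key β h).2⟩
    · obtain ⟨hp, h⟩ := key β hβ
      exact ⟨hp, h.trans fun x hx => hx.1, fun _ => h⟩

lemma mem_sub_or_orthogonal_or_mem_tails {l l' : List V} {g g' : V} {D : Set V}
    (hD : IsStandard b D) (hg : R.IsComponentTop D g) (hg' : R.IsComponentTop D g')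
    (hl : (g :: l).IsChain fun γ δ => R.IsComponentTop (R.orth γ) δ)
    (hl' : (g' :: l').IsChain fun γ δ => R.IsComponentTop (R.orth γ) δ)
    {β β' : V} (hβ : β ∈ g :: l) (hβ' : β' ∈ g' :: l') :
    (β' ∈ R.sub β ∨ ∀ φ ∈ R.sub β, ⟪φ, β'⟫_ℝ = 0) ∨ g = g' ∧ β ∈ l ∧ β' ∈ l' := by
  obtain ⟨-, hsub, htail⟩ := mem_pos_and_sub_subset_of_isChain hb hD hg hl β hβ
  obtain ⟨hp', hsub', -⟩ := mem_pos_and_sub_subset_of_isChain hb hD hg' hl' β' hβ'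
  have hmem' : β' ∈ R.sub g' := hsub' (mem_sub_self hb (R.pos_subset hp'))
  obtain ⟨C, hDC, hC⟩ := hg
  obtain ⟨C', hDC', hC'⟩ := hg'
  rcases hDC.eq_or_orthogonal hDC' with rfl | horth
  · obtain rfl := eq_of_isHighest hb hC hC'
    rcases List.mem_cons.1 hβ with rfl | hβl
    · exact .inl (.inl hmem')
    · rcases List.mem_cons.1 hβ' with rfl | hβl'
      · exact .inl (.inr fun φ hφ => (htail hβl hφ).2)
      · exact .inr ⟨rfl, hβl, hβl'⟩
  · exact .inl (.inr fun φ hφ => horth φ (sub_subset_component hb hD hDC hC.1 (hsub hφ)) β'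
      (sub_subset_component hb hD hDC' hC'.1 hmem'))

lemma mem_sub_or_orthogonal {l l' : List V} {g g' : V} {D : Set V} (hD : IsStandard b D)
    (hg : R.IsComponentTop D g) (hg' : R.IsComponentTop D g')
    (hl : (g :: l).IsChain fun γ δ => R.IsComponentTop (R.orth γ) δ)
    (hl' : (g' :: l').IsChain fun γ δ => R.IsComponentTop (R.orth γ) δ)
    {β β' : V} (hβ : β ∈ g :: l) (hβ' : β' ∈ g' :: l') :
    β' ∈ R.sub β ∨ ∀ φ ∈ R.sub β, ⟪φ, β'⟫_ℝ = 0 := by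
  induction l generalizing g g' l' D with
  | nil =>
    rcases mem_sub_or_orthogonal_or_mem_tails hb hD hg hg' hl hl' hβ hβ' with h | ⟨-, h, -⟩
    · exact h
    · simp at h
  | cons k l ih =>
    rcases mem_sub_or_orthogonal_or_mem_tails hb hD hg hg' hl hl' hβ hβ' with h | ⟨rfl, h, h'⟩
    · exact h
    · obtain ⟨k', l', rfl⟩ := List.exists_cons_of_ne_nil (List.ne_nil_of_mem h')
      obtain ⟨hk, hl⟩ := List.isChain_cons_cons.1 hl
      obtain ⟨hk', hl'⟩ := List.isChain_cons_cons.1 hl'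
      obtain ⟨C, hDC, hC⟩ := hg
      exact ih (isStandard_orth hb (isHighest_sub hb hD hDC hC)) hk hk' hl hl' h h'

end Chains

lemma mem_sub_or_orthogonal_of_mem_cascade {β β' : V} (hβ : β ∈ R.cascade)
    (hβ' : β' ∈ R.cascade) : β' ∈ R.sub β ∨ ∀ φ ∈ R.sub β, ⟪φ, β'⟫_ℝ = 0 := by
  obtain ⟨b, hb⟩ := exists_basis_simple R
  obtain ⟨l, ⟨-, hg, hl⟩, hβl⟩ := hβ
  obtain ⟨l', ⟨-, hg', hl'⟩, hβl'⟩ := hβ'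
  obtain ⟨g, l, rfl⟩ := List.exists_cons_of_ne_nil (List.ne_nil_of_mem hβl)
  obtain ⟨g', l', rfl⟩ := List.exists_cons_of_ne_nil (List.ne_nil_of_mem hβl')
  have hΔ : IsStandard b R.Δ := ⟨Set.univ, by ext; simp⟩
  exact mem_sub_or_orthogonal hb hΔ (hg g rfl) (hg' g' rfl) hl hl' hβl hβl'

lemma reflectRoot_mem_sub {β γ φ : V} (hβ : β ∈ R.sub γ) (hφ : φ ∈ R.sub γ) :
    reflectRoot β φ ∈ R.sub γ :=
  ⟨R.reflect_mem φ hφ.1 β hβ.1, Submodule.sub_mem _ hφ.2 (Submodule.smul_mem _ _ hβ.2)⟩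

end RootSystemData

/-- For `β, β′ ∈ ℬ`, the reflection `s_{β′}` maps `Δ(β)` onto itself, and
if its restriction to `Δ(β)` is not the identity then `β′ ∈ Δ(β)` (so that `s_{β′}` lies in
the Weyl group of `Δ(β)`). -/
theorem statement7 {V : Type*} [NormedAddCommGroup V] [InnerProductSpace ℝ V]
    (R : RootSystemData V) (β β' : V) (hβ : β ∈ R.cascade) (hβ' : β' ∈ R.cascade) :
    reflectRoot β' '' R.sub β = R.sub β ∧
    ((∃ φ ∈ R.sub β, reflectRoot β' φ ≠ φ) → β' ∈ R.sub β) := by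
  rcases RootSystemData.mem_sub_or_orthogonal_of_mem_cascade hβ hβ' with h | h
  · refine ⟨Set.Subset.antisymm ?_ fun φ hφ => ?_, fun _ => h⟩
    · rintro _ ⟨φ, hφ, rfl⟩
      exact RootSystemData.reflectRoot_mem_sub h hφ
    · exact ⟨_, RootSystemData.reflectRoot_mem_sub h hφ,
        RootSystemData.reflectRoot_reflectRoot h.1 φ⟩
  · have hid : ∀ φ ∈ R.sub β, reflectRoot β' φ = φ := fun φ hφ => by
      simp [reflectRoot, h φ hφ]
    refine ⟨?_, fun ⟨φ, hφ, hne⟩ => absurd (hid φ hφ) hne⟩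
    rw [Set.image_congr hid, Set.image_id']
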